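/- arXiv:2303.00547 — 2 statements merged into one kernel-verified Lean document; each statement's English description precedes it below -/
import Mathlib

section
/- Let X be a Hausdorff space, let S be a clopen subbase of X, and let (T, f) be an S-tree, i.e., T is an order tree and f : T → S is a surjection such that (F1) t ≤ t' implies f(t) ⊇ f(t'), and (F2) if t and t' are incomparable in T then f(t) ∩ f(t') = ∅. Then the map e : X → P(T) defined by e(x) = {t ∈ T : x ∈ f(t)} is a topological embedding of X into the path space P(T). -/
open Set Topology

universe u v

/-- An order tree: a partial order with a minimum element (the root) in which
the set of predecessors of every element is a well-ordered chain. -/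
def IsOrderTree (T : Type u) [PartialOrder T] : Prop :=
  (∃ r : T, ∀ t : T, r ≤ t) ∧
    ∀ t : T, IsChain (· ≤ ·) (Set.Iic t) ∧ (Set.Iic t).IsWF

/-- A tree is special if it is the union of countably many antichains. -/
def IsSpecialTree (T : Type u) [PartialOrder T] : Prop :=
  ∃ A : ℕ → Set T, (∀ n, IsAntichain (· ≤ ·) (A n)) ∧ (⋃ n, A n) = Set.univ

/-- A path of `T`: a down-closed chain. -/
def IsPath {T : Type u} [PartialOrder T] (x : Set T) : Prop :=
  IsChain (· ≤ ·) x ∧ ∀ ⦃s t : T⦄, s ≤ t → t ∈ x → s ∈ x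

/-- A ray: a path with no maximal element. -/
def IsRay {T : Type u} [PartialOrder T] (x : Set T) : Prop :=
  IsPath x ∧ ∀ t ∈ x, ∃ s ∈ x, t < s

/-- A branch: an inclusion-wise maximal path. -/
def IsBranch {T : Type u} [PartialOrder T] (x : Set T) : Prop :=
  IsPath x ∧ ∀ y : Set T, IsPath y → x ⊆ y → y = x

/-- The product topology of `2^T`, transported to `Set T` via characteristic
functions: it is generated by the sets `{s | t ∈ s}` and their complements. -/
def cylinderTopology (T : Type u) : TopologicalSpace (Set T) :=
  TopologicalSpace.generateFrom
    {C : Set (Set T) | ∃ t : T, C = {s : Set T | t ∈ s} ∨ C = {s : Set T | t ∉ s}}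

/-- The path space `P(T)`. -/
def PathSpace (T : Type u) [PartialOrder T] : Type u := {x : Set T // IsPath x}

/-- The ray space `R(T)`. -/
def RaySpace (T : Type u) [PartialOrder T] : Type u := {x : Set T // IsRay x}

/-- The branch space `B(T)`. -/
def BranchSpace (T : Type u) [PartialOrder T] : Type u := {x : Set T // IsBranch x}

instance PathSpace.topologicalSpace (T : Type u) [PartialOrder T] :
    TopologicalSpace (PathSpace T) :=
  TopologicalSpace.induced (fun x => x.1) (cylinderTopology T)

instance RaySpace.topologicalSpace (T : Type u) [PartialOrder T] :
    TopologicalSpace (RaySpace T) :=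
  TopologicalSpace.induced (fun x => x.1) (cylinderTopology T)

instance BranchSpace.topologicalSpace (T : Type u) [PartialOrder T] :
    TopologicalSpace (BranchSpace T) :=
  TopologicalSpace.induced (fun x => x.1) (cylinderTopology T)

/-- The subbasic set `[t] = {x ∈ R(T) : t ∈ x}`. -/
def raySet {T : Type u} [PartialOrder T] (t : T) : Set (RaySpace T) := {x | t ∈ x.1}

/-- The basic set `[t] = {x ∈ B(T) : t ∈ x}`. -/
def branchSet {T : Type u} [PartialOrder T] (t : T) : Set (BranchSpace T) := {x | t ∈ x.1}

/-- A top of a ray `x` is a node whose set of strict predecessors is exactly `x`. -/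
def IsTopOf {T : Type u} [PartialOrder T] (t : T) (x : Set T) : Prop := Set.Iio t = x

/-- `s` is a successor of `t`. -/
def IsSuccessorOf {T : Type u} [PartialOrder T] (s t : T) : Prop :=
  t < s ∧ ∀ u : T, t < u → u < s → False

/-- A tree is pruned if every node has a successor. -/
def IsPruned (T : Type u) [PartialOrder T] : Prop := ∀ t : T, ∃ s : T, IsSuccessorOf s t

/-- A family of sets is nested if any two intersecting members are ⊆-comparable. -/
def NestedFam {X : Type v} (𝒜 : Set (Set X)) : Prop :=
  ∀ A ∈ 𝒜, ∀ B ∈ 𝒜, (A ∩ B).Nonempty → A ⊆ B ∨ B ⊆ A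

/-- A family of sets is noetherian if every ⊆-increasing sequence of its members
is eventually constant. -/
def NoetherianFam {X : Type v} (𝒜 : Set (Set X)) : Prop :=
  ∀ f : ℕ → Set X, (∀ n, f n ∈ 𝒜) → Monotone f → ∃ N, ∀ n, N ≤ n → f n = f N

/-- A family of sets is centered if every finite subfamily has nonempty intersection. -/
def CenteredFam {X : Type v} (𝒜 : Set (Set X)) : Prop :=
  ∀ F : Finset (Set X), ↑F ⊆ 𝒜 → (⋂₀ (F : Set (Set X))).Nonempty

/-- A family of sets is complete if every centered subfamily has nonempty intersection. -/
def CompleteFam {X : Type v} (𝒜 : Set (Set X)) : Prop :=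
  ∀ 𝒞 ⊆ 𝒜, CenteredFam 𝒞 → (⋂₀ 𝒞).Nonempty

/-- A family is hereditarily complete if its trace on every closed set is complete. -/
def HeredCompleteFam {X : Type v} [TopologicalSpace X] (𝒜 : Set (Set X)) : Prop :=
  ∀ Y : Set X, IsClosed Y → CompleteFam {B : Set X | ∃ A ∈ 𝒜, B = A ∩ Y}

/-- A family is σ-disjoint if it is a countable union of pairwise disjoint subfamilies. -/
def SigmaDisjointFam {X : Type v} (𝒜 : Set (Set X)) : Prop :=
  ∃ D : ℕ → Set (Set X), (∀ n, (D n).Pairwise Disjoint) ∧ (⋃ n, D n) = 𝒜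

/-- `S` is a clopen subbase for `X` if the topology of `X` is the coarsest one in which
every member of `S` is clopen, i.e. it is generated by `S` together with the complements
of members of `S`. -/
def IsClopenSubbase {X : Type v} [t : TopologicalSpace X] (S : Set (Set X)) : Prop :=
  t = TopologicalSpace.generateFrom (S ∪ {B : Set X | ∃ A ∈ S, B = Aᶜ})

/-- `B` is a base for the topology of `X`. -/
def IsBaseFam {X : Type v} [TopologicalSpace X] (B : Set (Set X)) : Prop :=
  (∀ U ∈ B, IsOpen U) ∧ ∀ U : Set X, IsOpen U → ∀ x ∈ U, ∃ V ∈ B, x ∈ V ∧ V ⊆ U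
/-- For a Hausdorff space `X`, a clopen subbase `S` of `X` and an `S`-tree
`(T, f)`, the map `e : X → P(T)`, `e x = {t | x ∈ f t}`, is a topological embedding of
`X` into the path space `P(T)`. -/
theorem stmt13 {X : Type v} [TopologicalSpace X] [T2Space X]
    (S : Set (Set X)) (hS : IsClopenSubbase S)
    {T : Type u} [PartialOrder T] (hT : IsOrderTree T)
    (f : T → Set X) (hmem : ∀ t : T, f t ∈ S) (hsurj : ∀ A ∈ S, ∃ t : T, f t = A)
    (hF1 : ∀ s t : T, s ≤ t → f t ⊆ f s)
    (hF2 : ∀ s t : T, ¬ s ≤ t → ¬ t ≤ s → f s ∩ f t = ∅) :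
    ∃ e : X → PathSpace T, (∀ x : X, (e x).1 = {t : T | x ∈ f t}) ∧ IsEmbedding e := by
  have hpath : ∀ x : X, IsPath {t : T | x ∈ f t} := by
    refine fun x => ⟨fun s hs t ht _ => ?_, fun s t hst ht => hF1 s t hst ht⟩
    by_contra h
    rw [not_or] at h
    have hx : x ∈ f s ∩ f t := ⟨hs, ht⟩
    rw [hF2 s t h.1 h.2] at hx
    exact hx
  let e : X → PathSpace T := fun x => ⟨{t : T | x ∈ f t}, hpath x⟩
  have hind : IsInducing e := by
    refine ⟨?_⟩
    rw [PathSpace.topologicalSpace, induced_compose, cylinderTopology, induced_generateFrom_eq]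
    refine Eq.trans hS (congrArg TopologicalSpace.generateFrom ?_)
    ext A
    constructor
    · rintro (hA | ⟨B, hB, rfl⟩)
      · obtain ⟨t, rfl⟩ := hsurj A hA
        exact ⟨{s | t ∈ s}, ⟨t, Or.inl rfl⟩, rfl⟩
      · obtain ⟨t, rfl⟩ := hsurj B hB
        exact ⟨{s | t ∉ s}, ⟨t, Or.inr rfl⟩, rfl⟩
    · rintro ⟨_, ⟨t, rfl | rfl⟩, rfl⟩
      · exact Or.inl (hmem t)
      · exact Or.inr ⟨f t, hmem t, rfl⟩
  exact ⟨e, fun _ => rfl, hind, hind.injective⟩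
end

section
/- A topological space X embeds into the path space P(T) of some order tree T if and only if X is Hausdorff and admits a noetherian, nested clopen subbase. -/
open Set Topology

universe u v

/-- The topology induced by a map into a path space is generated by the preimages of the
cylinder sets. -/
theorem PathSpace.induced_eq_generateFrom {X : Type v} {T : Type u} [PartialOrder T]
    (e : X → PathSpace T) :
    TopologicalSpace.induced e (PathSpace.topologicalSpace T) =
      TopologicalSpace.generateFrom
        {B : Set X | ∃ t : T, B = {x | t ∈ (e x).1} ∨ B = {x | t ∉ (e x).1}} := by
  unfold PathSpace.topologicalSpace cylinderTopology
  rw [induced_compose, induced_generateFrom_eq]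
  congr 1
  ext B
  constructor
  · rintro ⟨C, ⟨t, rfl | rfl⟩, rfl⟩
    exacts [⟨t, Or.inl rfl⟩, ⟨t, Or.inr rfl⟩]
  · rintro ⟨t, rfl | rfl⟩
    exacts [⟨_, ⟨t, Or.inl rfl⟩, rfl⟩, ⟨_, ⟨t, Or.inr rfl⟩, rfl⟩]

theorem PathSpace.isOpen_setOf_mem {T : Type u} [PartialOrder T] (t : T) :
    IsOpen {x : PathSpace T | t ∈ x.1} :=
  isOpen_induced (t := cylinderTopology T) (s := {s : Set T | t ∈ s})
    (TopologicalSpace.isOpen_generateFrom_of_mem ⟨t, Or.inl rfl⟩)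

theorem PathSpace.isOpen_setOf_notMem {T : Type u} [PartialOrder T] (t : T) :
    IsOpen {x : PathSpace T | t ∉ x.1} :=
  isOpen_induced (t := cylinderTopology T) (s := {s : Set T | t ∉ s})
    (TopologicalSpace.isOpen_generateFrom_of_mem ⟨t, Or.inr rfl⟩)

instance PathSpace.t2Space (T : Type u) [PartialOrder T] : T2Space (PathSpace T) where
  t2 x y hxy := by
    obtain ⟨t, ht⟩ : ∃ t, ¬(t ∈ x.1 ↔ t ∈ y.1) := by
      by_contra! h
      exact hxy (Subtype.ext (Set.ext h))
    by_cases hx : t ∈ x.1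
    · exact ⟨_, _, isOpen_setOf_mem t, isOpen_setOf_notMem t, hx,
        fun hy => ht (iff_of_true hx hy), Set.disjoint_left.2 fun _ h h' => h' h⟩
    · exact ⟨_, _, isOpen_setOf_notMem t, isOpen_setOf_mem t, hx,
        by_contra fun hy => ht (iff_of_false hx hy), Set.disjoint_left.2 fun _ h h' => h h'⟩

/-- The traces `{x | t ∈ e x}` of the cylinder sets under a map into a path space. -/
def pathTraces {X : Type v} {T : Type u} [PartialOrder T] (e : X → PathSpace T) : Set (Set X) :=
  Set.range fun t : T => {x | t ∈ (e x).1}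

theorem nestedFam_pathTraces {X : Type v} {T : Type u} [PartialOrder T] (e : X → PathSpace T) :
    NestedFam (pathTraces e) := by
  rintro _ ⟨s, rfl⟩ _ ⟨t, rfl⟩ ⟨x, hs, ht⟩
  rcases (e x).2.1.total hs ht with h | h
  · exact Or.inr fun y hy => (e y).2.2 h hy
  · exact Or.inl fun y hy => (e y).2.2 h hy

theorem noetherianFam_pathTraces {X : Type v} {T : Type u} [PartialOrder T]
    (hT : ∀ t : T, (Set.Iic t).IsWF) (e : X → PathSpace T) :
    NoetherianFam (pathTraces e) := by
  intro f hf hmono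
  choose t ht using hf
  by_cases hne : ∃ k, (f k).Nonempty
  · obtain ⟨k, x, hx⟩ := hne
    have hmem : ∀ n, k ≤ n → t n ∈ (e x).1 := fun n hn => by
      have hxn := hmono hn hx
      rwa [← ht n] at hxn
    have hwf : (Set.Iic (t k) ∩ t '' Set.Ici k).IsWF := (hT (t k)).mono Set.inter_subset_left
    have hnon : (Set.Iic (t k) ∩ t '' Set.Ici k).Nonempty := ⟨t k, le_rfl, k, Set.self_mem_Ici, rfl⟩
    obtain ⟨hle, N, hN, hNeq⟩ := hwf.min_mem hnon
    have hmin : ∀ n, k ≤ n → t N ≤ t n := fun n hn => by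
      rcases (e x).2.1.total (hmem N hN) (hmem n hn) with h | h
      · exact h
      · rcases h.eq_or_lt with h' | h'
        · exact h'.ge
        · rw [hNeq] at h'
          exact absurd h' (hwf.not_lt_min hnon ⟨h'.le.trans hle, n, hn, rfl⟩)
    refine ⟨N, fun n hn => Set.Subset.antisymm ?_ (hmono hn)⟩
    rw [← ht n, ← ht N]
    exact fun y hy => (e y).2.2 (hmin n (le_trans hN hn)) hy
  · have hempty : ∀ n, f n = ∅ := fun n => Set.not_nonempty_iff_eq_empty.1 fun h => hne ⟨n, h⟩
    exact ⟨0, fun n _ => by rw [hempty n, hempty 0]⟩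

theorem isClopenSubbase_pathTraces {X : Type v} [TopologicalSpace X] {T : Type u}
    [PartialOrder T] {e : X → PathSpace T} (he : IsInducing e) :
    IsClopenSubbase (pathTraces e) := by
  rw [IsClopenSubbase, he.eq_induced, PathSpace.induced_eq_generateFrom]
  congr 1
  ext B
  constructor
  · rintro ⟨t, rfl | rfl⟩
    exacts [Or.inl ⟨t, rfl⟩, Or.inr ⟨_, ⟨t, rfl⟩, rfl⟩]
  · rintro (⟨t, rfl⟩ | ⟨_, ⟨t, rfl⟩, rfl⟩)
    exacts [⟨t, Or.inl rfl⟩, ⟨t, Or.inr rfl⟩]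

/-- The nonempty members of `S` together with the whole space, ordered by reverse inclusion. -/
abbrev FamTree {X : Type v} (S : Set (Set X)) : Type v :=
  {A : Set X // A = Set.univ ∨ A ∈ S ∧ A.Nonempty}ᵒᵈ

/-- The underlying set of a node of `FamTree S`. -/
def FamTree.set {X : Type v} {S : Set (Set X)} (A : FamTree S) : Set X := (OrderDual.ofDual A).1

theorem FamTree.le_iff {X : Type v} {S : Set (Set X)} {A B : FamTree S} :
    A ≤ B ↔ B.set ⊆ A.set := Iff.rfl

theorem FamTree.le_total_of_mem {X : Type v} {S : Set (Set X)} (hS : NestedFam S)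
    {A B : FamTree S} {x : X} (hA : x ∈ A.set) (hB : x ∈ B.set) : A ≤ B ∨ B ≤ A := by
  simp only [le_iff]
  rcases (OrderDual.ofDual A).2 with h | h
  · exact Or.inl ((Set.subset_univ _).trans h.ge)
  rcases (OrderDual.ofDual B).2 with h' | h'
  · exact Or.inr ((Set.subset_univ _).trans h'.ge)
  exact (hS _ h.1 _ h'.1 ⟨x, hA, hB⟩).symm

theorem FamTree.isOrderTree {X : Type v} {S : Set (Set X)} (hS : NestedFam S)
    (hN : NoetherianFam S) : IsOrderTree (FamTree S) := by
  refine ⟨⟨OrderDual.toDual ⟨Set.univ, Or.inl rfl⟩, fun t => Set.subset_univ t.set⟩,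
    fun t => ⟨fun A hA B hB _ => ?_, ?_⟩⟩
  · rcases (OrderDual.ofDual t).2 with h | ⟨-, x, hx⟩
    · have hB' : B.set = Set.univ := Set.univ_subset_iff.1 (h.ge.trans hB)
      exact Or.inr (le_iff.2 ((Set.subset_univ _).trans hB'.ge))
    · exact le_total_of_mem hS (hA hx) (hB hx)
  · rw [Set.isWF_iff_no_descending_seq]
    intro f hf _
    have hss : ∀ m n, m < n → (f m).set ⊂ (f n).set := fun m n h => hf h
    have hmem : ∀ n, (f n).set ∈ S := fun n => by
      rcases (OrderDual.ofDual (f n)).2 with h | h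
      · exact absurd ((Set.subset_univ _).trans h.ge) (hss n (n + 1) n.lt_succ_self).2
      · exact h.1
    obtain ⟨N, hN⟩ := hN (fun n => (f n).set) hmem
      (monotone_nat_of_le_succ fun n => (hss n (n + 1) n.lt_succ_self).1)
    exact (hss N (N + 1) N.lt_succ_self).ne (hN (N + 1) N.le_succ).symm

/-- The path of all members of the family containing a given point. -/
def FamTree.path {X : Type v} {S : Set (Set X)} (hS : NestedFam S) (x : X) :
    PathSpace (FamTree S) :=
  ⟨{A | x ∈ A.set}, fun _ hA _ hB _ => le_total_of_mem hS hA hB, fun _ _ h hx => h hx⟩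

theorem FamTree.isInducing_path {X : Type v} [t : TopologicalSpace X] {S : Set (Set X)}
    (hS : NestedFam S) (hsub : IsClopenSubbase S) : IsInducing (FamTree.path hS) := by
  refine ⟨?_⟩
  have hopen : ∀ A ∈ S, IsOpen A ∧ IsOpen Aᶜ := fun A hA => by
    rw [hsub]
    exact ⟨TopologicalSpace.isOpen_generateFrom_of_mem (Or.inl hA),
      TopologicalSpace.isOpen_generateFrom_of_mem (Or.inr ⟨A, hA, rfl⟩)⟩
  rw [PathSpace.induced_eq_generateFrom]
  refine le_antisymm (le_generateFrom ?_) ?_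
  · have key : ∀ A : FamTree S, IsOpen A.set ∧ IsOpen A.setᶜ := fun A => by
      rcases (OrderDual.ofDual A).2 with h | h
      · have h' : A.set = Set.univ := h
        simp [h']
      · exact hopen _ h.1
    rintro _ ⟨A, rfl | rfl⟩
    exacts [(key A).1, (key A).2]
  · conv_rhs => rw [hsub]
    refine le_generateFrom ?_
    rintro B (hB | ⟨B, hB, rfl⟩) <;> rcases B.eq_empty_or_nonempty with rfl | hne
    · exact @isOpen_empty _ (_)
    · exact TopologicalSpace.isOpen_generateFrom_of_mem
        ⟨OrderDual.toDual ⟨B, Or.inr ⟨hB, hne⟩⟩, Or.inl rfl⟩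
    · rw [Set.compl_empty]
      exact @isOpen_univ _ (_)
    · exact TopologicalSpace.isOpen_generateFrom_of_mem
        ⟨OrderDual.toDual ⟨B, Or.inr ⟨hB, hne⟩⟩, Or.inr rfl⟩

/-- A topological space `X` embeds into the path space of some order tree
iff `X` is Hausdorff and admits a noetherian, nested clopen subbase. -/
theorem stmt14 {X : Type u} [TopologicalSpace X] :
    (∃ (T : Type u) (_ : PartialOrder T), IsOrderTree T ∧
        ∃ e : X → PathSpace T, IsEmbedding e) ↔
    (T2Space X ∧ ∃ S : Set (Set X), IsClopenSubbase S ∧ NoetherianFam S ∧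
      NestedFam S) := by
  constructor
  · rintro ⟨T, _, hT, e, he⟩
    exact ⟨he.t2Space, pathTraces e, isClopenSubbase_pathTraces he.isInducing,
      noetherianFam_pathTraces (fun t => (hT.2 t).2) e, nestedFam_pathTraces e⟩
  · rintro ⟨_, S, hsub, hN, hS⟩
    exact ⟨FamTree S, inferInstance, FamTree.isOrderTree hS hN, FamTree.path hS,
      (FamTree.isInducing_path hS hsub).isEmbedding⟩
end
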